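/- Let G be a finite simple graph on vertex set {t_1,…,t_s} with at least one edge, let I(G) ⊆ S = K[t_1,…,t_s] be its edge ideal, let P_G = conv({e_i + e_j : {t_i,t_j} an edge of G}) ⊆ ℝ^s be its edge polytope, and let A(P_G) ⊆ S[z] be the Ehrhart ring of P_G. Then the K-subalgebra K[I(G)z] of S[z] generated by the elements t_i t_j z for edges {t_i,t_j} of G equals A(P_G) if and only if I(G) is a normal ideal, i.e., for every n ≥ 1 and every monomial t^a, the existence of p ≥ 1 with (t^a)^p ∈ I(G)^{pn} implies t^a ∈ I(G)^n. -/

import Mathlib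

open MvPolynomial

section Permutations

variable {X : Type*} [Fintype X] [DecidableEq X]

/-- An injective partial map along the edges of a graph, defined on `D`, can be traded for a
permutation moving at least `#D` vertices, all along edges.  If the partial map has no nonempty
invariant set (it is a union of paths), the number of moved vertices is even. -/
theorem exists_perm_of_injOn (H : SimpleGraph X) (f : X → X) (D : Finset X)
    (hf : Set.InjOn f D) (hadj : ∀ x ∈ D, H.Adj x (f x)) :
    ∃ σ : Equiv.Perm X, (∀ x ∈ σ.support, H.Adj x (σ x)) ∧ σ.support ⊆ D ∪ D.image f ∧
      D.card ≤ σ.support.card ∧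
      ((∃ D₀ ⊆ D, D₀.Nonempty ∧ D₀.image f = D₀) ∨ Even σ.support.card) := by
  induction D using Finset.strongInduction with
  | H D ih =>
  by_cases hsub : D ⊆ D.image f
  · have himg : D.image f = D :=
      (Finset.eq_of_subset_of_card_le hsub Finset.card_image_le).symm
    have hmem : ∀ x ∈ D, f x ∈ D := fun x hx => himg ▸ Finset.mem_image_of_mem f hx
    have hinj : Function.Injective (fun x => if x ∈ D then f x else x) := by
      intro x y hxy
      by_cases hx : x ∈ D <;> by_cases hy : y ∈ D <;> simp only [hx, hy, if_true, if_false] at hxy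
      · exact hf hx hy hxy
      · exact absurd (hxy ▸ hmem x hx) hy
      · exact absurd (hxy ▸ hmem y hy) hx
      · exact hxy
    let σ : Equiv.Perm X := Equiv.ofBijective _ (Finite.injective_iff_bijective.mp hinj)
    have hσ : ∀ x, σ x = if x ∈ D then f x else x := fun x => rfl
    have hsupp : σ.support = D := by
      ext x
      rw [Equiv.Perm.mem_support, hσ]
      by_cases hx : x ∈ D
      · simp [hx, (hadj x hx).ne']
      · simp [hx]
    refine ⟨σ, ?_, ?_, hsupp ▸ le_rfl, ?_⟩
    · intro x hx
      rw [hsupp] at hx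
      simpa [hσ, hx] using hadj x hx
    · rw [hsupp]; exact Finset.subset_union_left
    · rcases D.eq_empty_or_nonempty with h | h
      · right; simp [hsupp, h]
      · exact Or.inl ⟨D, subset_rfl, h, himg⟩
  · obtain ⟨x, hxD, hx⟩ := Finset.not_subset.mp hsub
    have hxf : ∀ y ∈ D, f y ≠ x := fun y hy h => hx (h ▸ Finset.mem_image_of_mem f hy)
    let D' := (D.erase x).erase (f x)
    have hD' : ∀ y, y ∈ D' ↔ y ≠ f x ∧ y ≠ x ∧ y ∈ D := by simp [D']
    have hsubD : D' ⊆ D := fun y hy => ((hD' y).mp hy).2.2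
    have hss : D' ⊂ D := ⟨hsubD, fun h => ((hD' x).mp (h hxD)).2.1 rfl⟩
    obtain ⟨τ, hτ, hτs, hτc, hτe⟩ := ih D' hss (hf.mono (by exact_mod_cast hsubD))
      (fun y hy => hadj y (hsubD hy))
    have hne : x ≠ f x := (hadj x hxD).ne
    have hnotx : x ∉ τ.support := fun h => by
      rcases Finset.mem_union.mp (hτs h) with h | h
      · exact ((hD' x).mp h).2.1 rfl
      · obtain ⟨y, hy, hyx⟩ := Finset.mem_image.mp h
        exact hxf y (hsubD hy) hyx
    have hnotfx : f x ∉ τ.support := fun h => by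
      rcases Finset.mem_union.mp (hτs h) with h | h
      · exact ((hD' _).mp h).1 rfl
      · obtain ⟨y, hy, hyx⟩ := Finset.mem_image.mp h
        exact ((hD' y).mp hy).2.1 (hf (hsubD hy) hxD hyx)
    have hdisj : Equiv.Perm.Disjoint (Equiv.swap x (f x)) τ := by
      rw [Equiv.Perm.disjoint_iff_disjoint_support, Equiv.Perm.support_swap hne]
      simp [Finset.disjoint_left] at hnotx hnotfx ⊢
      exact ⟨hnotx, hnotfx⟩
    have hcard := hdisj.card_support_mul
    rw [Equiv.Perm.card_support_swap hne] at hcard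
    refine ⟨Equiv.swap x (f x) * τ, ?_, ?_, ?_, ?_⟩
    · intro y hy
      rw [hdisj.support_mul, Equiv.Perm.support_swap hne] at hy
      by_cases hyτ : y ∈ τ.support
      · have h1 : τ y ∈ τ.support := Equiv.Perm.apply_mem_support.mpr hyτ
        rw [Equiv.Perm.mul_apply, Equiv.swap_apply_of_ne_of_ne]
        · exact hτ y hyτ
        · exact fun h => hnotx (h ▸ h1)
        · exact fun h => hnotfx (h ▸ h1)
      · rw [Equiv.Perm.mul_apply, Equiv.Perm.notMem_support.mp hyτ]
        have : y = x ∨ y = f x := by simpa [hyτ] using hy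
        rcases this with rfl | rfl
        · simpa using hadj _ hxD
        · simpa using (hadj _ hxD).symm
    · rw [hdisj.support_mul, Equiv.Perm.support_swap hne]
      intro y hy
      rcases Finset.mem_union.mp hy with hy | hy
      · have : y = x ∨ y = f x := by simpa using hy
        rcases this with rfl | rfl
        · exact Finset.mem_union_left _ hxD
        · exact Finset.mem_union_right _ (Finset.mem_image_of_mem f hxD)
      · exact Finset.union_subset_union hsubD (Finset.image_subset_image hsubD) (hτs hy)
    · have h1 : (D.erase x).card = D.card - 1 := Finset.card_erase_of_mem hxD
      have h2 : (D.erase x).card - 1 ≤ D'.card := Finset.pred_card_le_card_erase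
      omega
    · rcases hτe with ⟨D₀, h0, h1, h2⟩ | he
      · exact Or.inl ⟨D₀, h0.trans hsubD, h1, h2⟩
      · right
        rw [hcard]
        exact even_two.add he

/-- Deleting a vertex `y` from the support of a permutation along edges of a graph. -/
theorem exists_perm_avoiding (H : SimpleGraph X) (σ : Equiv.Perm X)
    (hσ : ∀ x ∈ σ.support, H.Adj x (σ x)) {y : X} (hy : y ∈ σ.support) :
    ∃ τ : Equiv.Perm X, (∀ x ∈ τ.support, H.Adj x (τ x)) ∧ τ.support ⊆ σ.support.erase y ∧
      σ.support.card ≤ τ.support.card + 2 ∧ (σ.IsCycle → Even τ.support.card) := by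
  let D := (σ.support.erase y).erase (σ⁻¹ y)
  have hD : ∀ x, x ∈ D ↔ x ≠ σ⁻¹ y ∧ x ≠ y ∧ x ∈ σ.support := by simp [D]
  obtain ⟨τ, h1, h2, h3, h4⟩ := exists_perm_of_injOn H σ D σ.injective.injOn
    (fun x hx => hσ x ((hD x).mp hx).2.2)
  refine ⟨τ, h1, h2.trans ?_, ?_, ?_⟩
  · intro x hx
    rcases Finset.mem_union.mp hx with hx | hx
    · exact Finset.mem_erase.mpr ((hD x).mp hx).2
    · obtain ⟨z, hz, rfl⟩ := Finset.mem_image.mp hx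
      obtain ⟨hz1, -, hz3⟩ := (hD z).mp hz
      refine Finset.mem_erase.mpr ⟨fun h => hz1 ?_, Equiv.Perm.apply_mem_support.mpr hz3⟩
      rw [← h]; simp
  · have e1 : (σ.support.erase y).card = σ.support.card - 1 := Finset.card_erase_of_mem hy
    have e2 : (σ.support.erase y).card - 1 ≤ D.card := Finset.pred_card_le_card_erase
    omega
  · intro hc
    rcases h4 with ⟨D₀, hD₀, ⟨z, hz⟩, himg⟩ | he
    · exfalso
      have hz' := (hD z).mp (hD₀ hz)
      obtain ⟨i, hi⟩ := (hc.sameCycle (Equiv.Perm.mem_support.mp hz'.2.2)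
        (Equiv.Perm.mem_support.mp hy)).exists_nat_pow_eq
      have hpow : ∀ i : ℕ, (σ ^ i) z ∈ D₀ := by
        intro i
        induction i with
        | zero => simpa using hz
        | succ i ih =>
          rw [pow_succ', Equiv.Perm.mul_apply, ← himg]
          exact Finset.mem_image_of_mem σ ih
      exact ((hD y).mp (hD₀ (hi ▸ hpow i))).2.1 rfl
    · exact he

/-- If an odd number of vertices is moved, one of them can be dropped. -/
theorem exists_perm_card_support_add_one (H : SimpleGraph X) (σ : Equiv.Perm X)
    (hσ : ∀ x ∈ σ.support, H.Adj x (σ x)) (hodd : Odd σ.support.card) :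
    ∃ τ : Equiv.Perm X, (∀ x ∈ τ.support, H.Adj x (τ x)) ∧
      τ.support.card + 1 = σ.support.card := by
  have hex : ∃ c ∈ σ.cycleFactorsFinset, Odd c.support.card := by
    by_contra! hcon
    refine (Nat.not_even_iff_odd.mpr hodd) ?_
    rw [← Equiv.Perm.sum_cycleType, Equiv.Perm.cycleType_def]
    refine Finset.sum_induction (fun c : Equiv.Perm X => c.support.card) Even
      (fun _ _ => Even.add) Even.zero fun c hc => ?_
    exact Nat.not_odd_iff_even.mp (hcon c hc)
  obtain ⟨c, hcσ, hcodd⟩ := hex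
  have hc := Equiv.Perm.mem_cycleFactorsFinset_iff.mp hcσ
  have hcσ' : ∀ x ∈ c.support, H.Adj x (c x) := fun x hx => by
    rw [hc.2 x hx]
    exact hσ x (Equiv.Perm.mem_cycleFactorsFinset_support_le hcσ hx)
  obtain ⟨y, hy⟩ : c.support.Nonempty := Finset.card_pos.mp hcodd.pos
  obtain ⟨τ, h1, h2, h3, h4⟩ := exists_perm_avoiding H c hcσ' hy
  have h5 : τ.support.card + 1 = c.support.card := by
    have e1 := Finset.card_le_card h2
    rw [Finset.card_erase_of_mem hy] at e1
    have e2 := hcodd.pos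
    have e3 := h4 hc.1
    grind
  have hdisj : Equiv.Perm.Disjoint (σ * c⁻¹) c :=
    Equiv.Perm.disjoint_mul_inv_of_mem_cycleFactorsFinset hcσ
  have hdisj' : Equiv.Perm.Disjoint (σ * c⁻¹) τ :=
    hdisj.mono le_rfl (h2.trans (Finset.erase_subset _ _))
  have hcard : σ.support.card = (σ * c⁻¹).support.card + c.support.card := by
    rw [← hdisj.card_support_mul]; simp
  refine ⟨σ * c⁻¹ * τ, ?_, ?_⟩
  · intro x hx
    rw [hdisj'.support_mul] at hx
    by_cases hxτ : x ∈ τ.support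
    · have : τ x ∉ (σ * c⁻¹).support := fun h => Finset.disjoint_left.mp
        (Equiv.Perm.disjoint_iff_disjoint_support.mp hdisj') h
        (Equiv.Perm.apply_mem_support.mpr hxτ)
      rw [Equiv.Perm.mul_apply, Equiv.Perm.notMem_support.mp this]
      exact h1 x hxτ
    · have hx' : x ∈ (σ * c⁻¹).support := by simpa [hxτ] using hx
      have hxc : x ∉ c.support :=
        Finset.disjoint_left.mp (Equiv.Perm.disjoint_iff_disjoint_support.mp hdisj) hx'
      have hxc' : c⁻¹ x = x := by
        rw [Equiv.Perm.inv_eq_iff_eq]; exact (Equiv.Perm.notMem_support.mp hxc).symm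
      have hval : (σ * c⁻¹) x = σ x := by rw [Equiv.Perm.mul_apply, hxc']
      rw [Equiv.Perm.mul_apply, Equiv.Perm.notMem_support.mp hxτ, hval]
      refine hσ x ?_
      rw [Equiv.Perm.mem_support, ← hval]
      exact Equiv.Perm.mem_support.mp hx'
  · rw [hdisj'.card_support_mul]
    omega

/-- The number of moved vertices can be lowered to any prescribed even number. -/
theorem exists_perm_card_support_eq (H : SimpleGraph X) {m : ℕ} (hm : Even m) (σ : Equiv.Perm X)
    (hσ : ∀ x ∈ σ.support, H.Adj x (σ x)) (hle : m ≤ σ.support.card) :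
    ∃ τ : Equiv.Perm X, (∀ x ∈ τ.support, H.Adj x (τ x)) ∧ τ.support.card = m := by
  induction hk : σ.support.card using Nat.strong_induction_on generalizing σ with
  | _ k ih =>
  subst hk
  rcases hle.eq_or_lt with h | h
  · exact ⟨σ, hσ, h.symm⟩
  · rcases (Nat.succ_le_of_lt h).eq_or_lt with h' | h'
    · obtain ⟨τ, h1, h2⟩ := exists_perm_card_support_add_one H σ hσ (h' ▸ hm.add_one)
      exact ⟨τ, h1, by omega⟩
    · obtain ⟨y, hy⟩ : σ.support.Nonempty := Finset.card_pos.mp (by omega)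
      obtain ⟨τ, h1, h2, h3, -⟩ := exists_perm_avoiding H σ hσ hy
      have e := Finset.card_le_card h2
      rw [Finset.card_erase_of_mem hy] at e
      exact ih _ (by omega) τ h1 (by omega) rfl

end Permutations

/-- Hall's theorem with deficiency `k`. -/
theorem exists_injOn_of_card_le_add {X Y : Type*} [Fintype X] [DecidableEq Y]
    (t : X → Finset Y) (k : ℕ)
    (h : ∀ S : Finset X, S.card ≤ (S.biUnion t).card + k) :
    ∃ (D : Finset X) (f : X → Option Y), Fintype.card X ≤ D.card + k ∧ Set.InjOn f D ∧
      ∀ x ∈ D, ∃ y ∈ t x, f x = some y := by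
  let T : X → Finset (Y ⊕ Fin k) := fun x => (t x).disjSum Finset.univ
  have hT : ∀ S : Finset X, S.card ≤ (S.biUnion T).card := by
    intro S
    rcases S.eq_empty_or_nonempty with rfl | ⟨x₀, hx₀⟩
    · simp
    · have : S.biUnion T = (S.biUnion t).disjSum Finset.univ := by
        ext z
        rcases z with z | z
        · simp [T]
        · simp only [T, Finset.mem_biUnion, Finset.inr_mem_disjSum, Finset.mem_univ, and_true,
            iff_true]
          exact ⟨x₀, hx₀⟩
      rw [this, Finset.card_disjSum]
      simpa using h S
  obtain ⟨g, hg, hgT⟩ := (Finset.all_card_le_biUnion_card_iff_exists_injective T).mp hT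
  let D : Finset X := Finset.univ.filter fun x => (g x).isLeft
  refine ⟨D, fun x => (g x).getLeft?, ?_, ?_, ?_⟩
  · have h1 : (Finset.univ.filter fun x => ¬ (g x).isLeft).card ≤ k := by
      have := Finset.card_le_card_of_injOn (s := Finset.univ.filter fun x => ¬ (g x).isLeft)
        (t := Finset.univ.map (Function.Embedding.inr : Fin k ↪ Y ⊕ Fin k)) g
        (by
          intro x hx
          rcases hgx : g x with z | z <;> simp [hgx] at hx ⊢)
        hg.injOn
      simpa using this
    have h2 := Finset.card_filter_add_card_filter_not (s := (Finset.univ : Finset X))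
      (fun x => ((g x).isLeft : Prop))
    rw [Finset.card_univ] at h2
    change _ ≤ (Finset.univ.filter fun x => ((g x).isLeft : Prop)).card + k
    omega
  · intro x hx y hy hxy
    apply hg
    simp only [D, Finset.coe_filter, Finset.mem_univ, true_and, Set.mem_ofPred_eq] at hx hy
    rcases hgx : g x with z | z <;> rcases hgy : g y with z' | z' <;> simp_all
  · intro x hx
    have hx : (g x).isLeft := by simpa [D] using hx
    have := hgT x
    rcases hgx : g x with z | z
    · rw [hgx] at this
      exact ⟨z, by simpa [T] using this, by simp [hgx]⟩
    · simp [hgx] at hx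

section EdgeSums

variable {V : Type*}

/-- `IsEdgeSum G n c` says that `c` is a sum of `n` vectors `e_i + e_j` with `{i, j}` an edge. -/
inductive IsEdgeSum (G : SimpleGraph V) : ℕ → (V →₀ ℕ) → Prop
  | zero : IsEdgeSum G 0 0
  | add_edge {n : ℕ} {c : V →₀ ℕ} {i j : V} (hij : G.Adj i j) (hc : IsEdgeSum G n c) :
      IsEdgeSum G (n + 1) (Finsupp.single i 1 + Finsupp.single j 1 + c)

variable {G : SimpleGraph V}

theorem IsEdgeSum.edge {i j : V} (hij : G.Adj i j) :
    IsEdgeSum G 1 (Finsupp.single i 1 + Finsupp.single j 1) := by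
  simpa using IsEdgeSum.zero.add_edge hij

theorem IsEdgeSum.add {m n : ℕ} {b c : V →₀ ℕ} (hb : IsEdgeSum G m b) (hc : IsEdgeSum G n c) :
    IsEdgeSum G (m + n) (b + c) := by
  induction hb with
  | zero => simpa using hc
  | add_edge hij _ ih =>
    convert ih.add_edge hij using 1
    · omega
    · rw [add_assoc]

theorem IsEdgeSum.degree_eq {n : ℕ} {c : V →₀ ℕ} (hc : IsEdgeSum G n c) : c.degree = 2 * n := by
  induction hc with
  | zero => simp
  | add_edge hij _ ih => simp [ih]; ring

theorem isEdgeSum_sum {X : Type*} (S : Finset X) (f g : X → V)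
    (h : ∀ x ∈ S, G.Adj (f x) (g x)) :
    IsEdgeSum G S.card (∑ x ∈ S, (Finsupp.single (f x) 1 + Finsupp.single (g x) 1)) := by
  classical
  induction S using Finset.induction_on with
  | empty => simpa using IsEdgeSum.zero
  | insert x S hx ih =>
    rw [Finset.card_insert_of_notMem hx, Finset.sum_insert hx]
    exact (ih fun y hy => h y (Finset.mem_insert_of_mem hy)).add_edge
      (h x (Finset.mem_insert_self _ _))

end EdgeSums

theorem card_sigma_filter_fst {V : Type*} [Fintype V] (a : V → ℕ) (T : Finset V) [DecidablePred (· ∈ T)] :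
    (Finset.univ.filter fun x : Σ v, Fin (a v) => x.1 ∈ T).card = ∑ v ∈ T, a v := by
  have : (Finset.univ.filter fun x : Σ v, Fin (a v) => x.1 ∈ T) =
      T.sigma fun v => (Finset.univ : Finset (Fin (a v))) := by
    ext; simp
  rw [this, Finset.card_sigma]
  simp

section EdgePolytope

variable {V : Type*} [DecidableEq V]

/-- The edge polytope of a graph. -/
def edgePolytope (G : SimpleGraph V) : Set (V → ℝ) :=
  convexHull ℝ {u : V → ℝ | ∃ i j : V, G.Adj i j ∧ u = Pi.single i (1 : ℝ) + Pi.single j 1}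

variable {G : SimpleGraph V}

theorem IsEdgeSum.mem_smul_edgePolytope (hG : ∃ i j, G.Adj i j) {n : ℕ} {c : V →₀ ℕ}
    (hc : IsEdgeSum G n c) : ∃ x ∈ edgePolytope G, (fun i => (c i : ℝ)) = (n : ℝ) • x := by
  induction hc with
  | zero =>
    obtain ⟨i, j, hij⟩ := hG
    refine ⟨_, subset_convexHull ℝ _ ⟨i, j, hij, rfl⟩, ?_⟩
    ext; simp
  | @add_edge n c i j hij _ ih =>
    obtain ⟨x, hx, hcx⟩ := ih
    have hy : Pi.single i (1 : ℝ) + Pi.single j 1 ∈ edgePolytope G :=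
      subset_convexHull ℝ _ ⟨i, j, hij, rfl⟩
    have hn : (0 : ℝ) < n + 1 := by positivity
    refine ⟨_, (convex_convexHull ℝ _) hx hy (a := n / (n + 1)) (b := 1 / (n + 1))
      (by positivity) (by positivity) (by field_simp), ?_⟩
    ext k
    have hck := congrFun hcx k
    simp only [Pi.smul_apply, smul_eq_mul] at hck
    simp only [Finsupp.add_apply, Nat.cast_add, hck, Pi.smul_apply, Pi.add_apply, smul_eq_mul,
      Finsupp.single_apply, Pi.single_apply, Nat.cast_ite, Nat.cast_one, Nat.cast_zero,
      @eq_comm _ k]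
    field_simp
    ring

variable [Fintype V]

/-- A point of the edge polytope is the vector of row sums of a symmetric nonnegative matrix
supported on the edges. -/
theorem exists_weight_of_mem_edgePolytope {x : V → ℝ} (hx : x ∈ edgePolytope G) :
    ∃ w : V → V → ℝ, (∀ u v, 0 ≤ w u v) ∧ (∀ u v, w u v = w v u) ∧
      (∀ u v, ¬ G.Adj u v → w u v = 0) ∧ (∀ u, ∑ v, w u v = x u) ∧ ∑ u, x u = 2 := by
  let C : Set (V → ℝ) := {x | ∃ w : V → V → ℝ, (∀ u v, 0 ≤ w u v) ∧ (∀ u v, w u v = w v u) ∧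
      (∀ u v, ¬ G.Adj u v → w u v = 0) ∧ (∀ u, ∑ v, w u v = x u) ∧ ∑ u, x u = 2}
  refine (convexHull_min (t := C) ?_ ?_ : _ ⊆ C) hx
  · rintro _ ⟨i, j, hij, rfl⟩
    refine ⟨fun u v => (Pi.single i 1 : V → ℝ) u * (Pi.single j 1 : V → ℝ) v +
      (Pi.single j 1 : V → ℝ) u * (Pi.single i 1 : V → ℝ) v, ?_, ?_, ?_, ?_, ?_⟩
    · intro u v
      simp only [Pi.single_apply]
      positivity
    · intro u v
      ring
    · intro u v huv
      simp only [Pi.single_apply]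
      have := hij.symm
      split_ifs <;> simp_all
    · intro u
      rw [Finset.sum_add_distrib, ← Finset.mul_sum, ← Finset.mul_sum]
      simp
    · simp [Finset.sum_add_distrib]
      norm_num
  · rintro x ⟨w, h1, h2, h3, h4, h5⟩ y ⟨w', h1', h2', h3', h4', h5'⟩ a b ha hb hab
    refine ⟨fun u v => a * w u v + b * w' u v, ?_, ?_, ?_, ?_, ?_⟩
    · intro u v
      have := h1 u v
      have := h1' u v
      positivity
    · intro u v
      simp only [h2 u v, h2' u v]
    · intro u v huv
      simp [h3 u v huv, h3' u v huv]
    · intro u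
      simp [Finset.sum_add_distrib, ← Finset.mul_sum, h4, h4']
    · simp only [Pi.add_apply, Pi.smul_apply, smul_eq_mul, Finset.sum_add_distrib,
        ← Finset.mul_sum, h5, h5']
      rw [← add_mul, hab, one_mul]

/-- Half-integrality of fractional `a`-matchings: a point of `n P_G` below the lattice point `a`
can be replaced by a lattice point. -/
theorem exists_le_of_smul_le {n : ℕ} {x : V → ℝ} (hx : x ∈ edgePolytope G) (a : V →₀ ℕ)
    (hxa : ∀ i, n * x i ≤ a i) :
    ∃ b ≤ a, b.degree = 2 * n ∧ IsEdgeSum G (2 * n) (2 • b) := by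
  classical
  obtain ⟨w, hw0, hws, hwG, hwx, hx2⟩ := exists_weight_of_mem_edgePolytope hx
  let X := Σ v, Fin (a v)
  have hX : Fintype.card X = ∑ v, a v := by simp [X]
  have htot : ∑ v, (n * x v : ℝ) = 2 * n := by rw [← Finset.mul_sum, hx2, mul_comm]
  have hnX : 2 * n ≤ Fintype.card X := by
    rw [hX]
    have := Finset.sum_le_sum fun v (_ : v ∈ Finset.univ) => hxa v
    rw [htot] at this
    exact_mod_cast this
  let H : SimpleGraph X := G.comap Sigma.fst
  let t : X → Finset X := fun p => Finset.univ.filter fun q => H.Adj p q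
  have hall : ∀ S : Finset X, S.card ≤ (S.biUnion t).card + (Fintype.card X - 2 * n) := by
    intro S
    let S₀ := S.image Sigma.fst
    let T := Finset.univ.filter fun v => ∃ u ∈ S₀, G.Adj u v
    have h1 : S.card ≤ ∑ v ∈ S₀, a v := by
      rw [← card_sigma_filter_fst]
      refine Finset.card_le_card fun p hp => ?_
      exact Finset.mem_filter.mpr ⟨Finset.mem_univ _, Finset.mem_image_of_mem Sigma.fst hp⟩
    have h2 : ∑ v ∈ T, a v ≤ (S.biUnion t).card := by
      rw [← card_sigma_filter_fst]
      refine Finset.card_le_card fun q hq => ?_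
      have hq : q.1 ∈ T := by simpa using hq
      obtain ⟨u, hu, huq⟩ := (Finset.mem_filter.mp hq).2
      obtain ⟨p, hp, rfl⟩ := Finset.mem_image.mp hu
      exact Finset.mem_biUnion.mpr ⟨p, hp, by simpa [t, H] using huq⟩
    have h3 : ∑ v ∈ S₀, a v + ∑ v ∈ S₀ᶜ, a v = Fintype.card X := by
      rw [hX, Finset.sum_add_sum_compl]
    have h4 : (2 * n : ℝ) ≤ ∑ v ∈ T, (a v : ℝ) + ∑ v ∈ S₀ᶜ, (a v : ℝ) := by
      rw [← htot, ← Finset.sum_add_sum_compl S₀]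
      refine add_le_add ?_ (Finset.sum_le_sum fun v _ => hxa v)
      calc ∑ u ∈ S₀, (n * x u : ℝ) = ∑ u ∈ S₀, ∑ v ∈ T, n * w u v := by
            refine Finset.sum_congr rfl fun u hu => ?_
            rw [← hwx, Finset.mul_sum]
            refine (Finset.sum_subset (Finset.subset_univ T) fun v _ hv => ?_).symm
            rw [hwG, mul_zero]
            exact fun h => hv (Finset.mem_filter.mpr ⟨Finset.mem_univ _, u, hu, h⟩)
        _ = ∑ v ∈ T, ∑ u ∈ S₀, n * w u v := Finset.sum_comm
        _ ≤ ∑ v ∈ T, (a v : ℝ) := by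
            refine Finset.sum_le_sum fun v _ => le_trans ?_ (hxa v)
            rw [← hwx, Finset.mul_sum]
            simp_rw [hws v]
            exact Finset.sum_le_sum_of_subset_of_nonneg (Finset.subset_univ _)
              fun u _ _ => mul_nonneg n.cast_nonneg (hw0 _ _)
    have h5 : 2 * n ≤ ∑ v ∈ T, a v + ∑ v ∈ S₀ᶜ, a v := by exact_mod_cast h4
    omega
  obtain ⟨D, f, hD, hf, hfD⟩ := exists_injOn_of_card_le_add t _ hall
  have hfD' : ∀ p ∈ D, ∃ q, H.Adj p q ∧ f p = some q := fun p hp => by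
    obtain ⟨q, hq, hpq⟩ := hfD p hp
    exact ⟨q, (Finset.mem_filter.mp hq).2, hpq⟩
  obtain ⟨σ, hσ, -, hσc, -⟩ := exists_perm_of_injOn H (fun p => (f p).getD p) D
    (by
      intro p hp q hq hpq
      obtain ⟨p', -, hp'⟩ := hfD' p hp
      obtain ⟨q', -, hq'⟩ := hfD' q hq
      apply hf hp hq
      simp only [hp', hq', Option.getD_some] at hpq ⊢
      rw [hpq])
    (by
      intro p hp
      obtain ⟨p', h, hp'⟩ := hfD' p hp
      simpa [hp'] using h)
  obtain ⟨τ, hτ, hτc⟩ := exists_perm_card_support_eq H (even_two_mul n) σ hσ (by omega)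
  refine ⟨∑ p ∈ τ.support, Finsupp.single p.1 1, ?_, ?_, ?_⟩
  · calc ∑ p ∈ τ.support, Finsupp.single p.1 1
        ≤ ∑ p : X, Finsupp.single p.1 1 :=
          Finset.sum_le_sum_of_subset (Finset.subset_univ _)
      _ = a := by
          rw [Fintype.sum_sigma]
          simp [Finsupp.univ_sum_single]
  · simp [map_sum, hτc]
  · rw [← hτc, two_nsmul]
    nth_rewrite 2 [← Equiv.Perm.sum_comp τ τ.support (fun p => Finsupp.single p.1 1)
      (fun p hp => Equiv.Perm.mem_support.mpr hp)]
    rw [← Finset.sum_add_distrib]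
    exact isEdgeSum_sum _ _ _ fun p hp => hτ p hp

end EdgePolytope

section MonomialSpans

variable {σ K : Type*} [Field K]

/-- The powers of an edge ideal are spanned by the monomials of sums of edges. -/
theorem edgeIdeal_pow_eq_span (G : SimpleGraph σ) (n : ℕ) :
    Ideal.span {f : MvPolynomial σ K | ∃ i j, G.Adj i j ∧ f = X i * X j} ^ n =
      Ideal.span ((fun c => monomial c (1 : K)) '' {c | IsEdgeSum G n c}) := by
  have hXX : ∀ i j : σ, (X i * X j : MvPolynomial σ K) =
      monomial (Finsupp.single i 1 + Finsupp.single j 1) 1 := by simp [X]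
  induction n with
  | zero =>
    rw [pow_zero, Ideal.one_eq_top, eq_comm, Ideal.eq_top_iff_one]
    exact Ideal.subset_span ⟨0, IsEdgeSum.zero, by simp⟩
  | succ n ih =>
    rw [pow_succ', ih, Ideal.span_mul_span']
    congr 1
    ext f
    simp only [Set.mem_mul]
    constructor
    · rintro ⟨_, ⟨i, j, hij, rfl⟩, _, ⟨c, hc, rfl⟩, rfl⟩
      exact ⟨_, hc.add_edge hij, by simp [hXX]⟩
    · rintro ⟨_, h, rfl⟩
      cases h with
      | @add_edge _ c i j hij hc => exact ⟨_, ⟨i, j, hij, rfl⟩, _, ⟨c, hc, rfl⟩, by simp [hXX]⟩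

theorem monomial_mem_edgeIdeal_pow_iff (G : SimpleGraph σ) (n : ℕ) (a : σ →₀ ℕ) :
    monomial a (1 : K) ∈
        Ideal.span {f : MvPolynomial σ K | ∃ i j, G.Adj i j ∧ f = X i * X j} ^ n ↔
      ∃ c ≤ a, IsEdgeSum G n c := by
  classical
  rw [edgeIdeal_pow_eq_span, mem_ideal_span_monomial_image]
  simp [support_monomial, and_comm]

/-- A monomial lies in a span of monomials only if it is one of them. -/
theorem monomial_monomial_mem_span_iff (T : Set (ℕ × (σ →₀ ℕ))) (n : ℕ) (c : σ →₀ ℕ) :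
    Polynomial.monomial n (monomial c (1 : K)) ∈
        Submodule.span K ((fun q : ℕ × (σ →₀ ℕ) =>
          Polynomial.monomial q.1 (monomial q.2 (1 : K))) '' T) ↔ (n, c) ∈ T := by
  classical
  refine ⟨fun h => ?_, fun h => Submodule.subset_span ⟨_, h, rfl⟩⟩
  by_contra hT
  let φ : Polynomial (MvPolynomial σ K) →ₗ[K] K :=
    lcoeff K c ∘ₗ (Polynomial.lcoeff (MvPolynomial σ K) n).restrictScalars K
  have hφ : Submodule.span K ((fun q : ℕ × (σ →₀ ℕ) =>
      Polynomial.monomial q.1 (monomial q.2 (1 : K))) '' T) ≤ LinearMap.ker φ := by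
    rw [Submodule.span_le]
    rintro _ ⟨⟨m, d⟩, hd, rfl⟩
    simp only [SetLike.mem_coe, LinearMap.mem_ker, φ, LinearMap.comp_apply,
      LinearMap.restrictScalars_apply, Polynomial.lcoeff_apply, lcoeff_apply,
      Polynomial.coeff_monomial]
    by_cases hm : m = n
    · subst hm
      rw [if_pos rfl, coeff_monomial, if_neg]
      rintro rfl
      exact hT hd
    · rw [if_neg hm, coeff_zero]
  have := hφ h
  simp [φ] at this

/-- The edge subring is spanned by the monomials of sums of edges. -/
theorem edgeSubring_toSubmodule_eq_span (G : SimpleGraph σ) :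
    Subalgebra.toSubmodule (Algebra.adjoin K
      {p : Polynomial (MvPolynomial σ K) |
        ∃ i j, G.Adj i j ∧ p = Polynomial.C (X i * X j) * Polynomial.X}) =
      Submodule.span K ((fun q : ℕ × (σ →₀ ℕ) =>
        Polynomial.monomial q.1 (monomial q.2 (1 : K))) '' {q | IsEdgeSum G q.1 q.2}) := by
  have hXX : ∀ i j : σ, (Polynomial.C (X i * X j) * Polynomial.X :
      Polynomial (MvPolynomial σ K)) =
      Polynomial.monomial 1 (monomial (Finsupp.single i 1 + Finsupp.single j 1) 1) := by
    intro i j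
    rw [← pow_one Polynomial.X, Polynomial.C_mul_X_pow_eq_monomial]
    simp [X]
  rw [Algebra.adjoin_eq_span]
  congr 1
  ext f
  constructor
  · intro hf
    induction hf using Submonoid.closure_induction with
    | mem f hf =>
      obtain ⟨i, j, hij, rfl⟩ := hf
      exact ⟨(1, _), IsEdgeSum.edge hij, (hXX i j).symm⟩
    | one => exact ⟨(0, 0), IsEdgeSum.zero, by simp⟩
    | mul f g _ _ hf hg =>
      obtain ⟨q, hq, rfl⟩ := hf
      obtain ⟨r, hr, rfl⟩ := hg
      exact ⟨(q.1 + r.1, q.2 + r.2), hq.add hr, by simp [Polynomial.monomial_mul_monomial]⟩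
  · rintro ⟨⟨n, c⟩, hq, rfl⟩
    change IsEdgeSum G n c at hq
    simp only [SetLike.mem_coe]
    induction hq with
    | zero => simp
    | @add_edge n c i j hij _ ih =>
      have := mul_mem ih (Submonoid.subset_closure (s := {p : Polynomial (MvPolynomial σ K) |
        ∃ i j, G.Adj i j ∧ p = Polynomial.C (X i * X j) * Polynomial.X}) ⟨i, j, hij, rfl⟩)
      rw [hXX, Polynomial.monomial_mul_monomial, monomial_mul, one_mul, add_comm c] at this
      exact this

theorem prod_X_pow_eq_monomial_equivFunOnFinite [Fintype σ] (a : σ → ℕ) :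
    (∏ i, X i ^ a i : MvPolynomial σ K) = monomial (Finsupp.equivFunOnFinite.symm a) 1 := by
  rw [prod_X_pow]
  congr 2
  ext i
  exact Finsupp.indicator_of_mem (Finset.mem_univ i) _

end MonomialSpans

/-- Every lattice point of every dilation `n P_G` is a sum of `n` edges if and only if the set of
sums of edges satisfies the combinatorial form of normality of the edge ideal. -/
theorem edgeSums_eq_lattice_points_iff {V : Type*} [Fintype V] [DecidableEq V]
    {G : SimpleGraph V} (hG : ∃ i j, G.Adj i j) :
    (∀ (n : ℕ) (a : V →₀ ℕ),
        (∃ x ∈ edgePolytope G, (fun i => (a i : ℝ)) = (n : ℝ) • x) → IsEdgeSum G n a) ↔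
      ∀ n : ℕ, 1 ≤ n → ∀ a : V →₀ ℕ,
        (∃ p : ℕ, 1 ≤ p ∧ ∃ c ≤ p • a, IsEdgeSum G (p * n) c) → ∃ c ≤ a, IsEdgeSum G n c := by
  have hhalf : ∀ (n : ℕ) (b : V →₀ ℕ), IsEdgeSum G (2 * n) (2 • b) →
      ∃ x ∈ edgePolytope G, (fun i => (b i : ℝ)) = (n : ℝ) • x := by
    intro n b hb
    obtain ⟨x, hx, hbx⟩ := hb.mem_smul_edgePolytope hG
    refine ⟨x, hx, ?_⟩
    ext i
    have := congrFun hbx i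
    simp only [Finsupp.smul_apply, smul_eq_mul, Nat.cast_mul, Nat.cast_ofNat,
      Pi.smul_apply] at this ⊢
    linarith
  constructor
  · rintro h n - a ⟨p, hp, c, hca, hc⟩
    obtain ⟨x, hx, hcx⟩ := hc.mem_smul_edgePolytope hG
    obtain ⟨b, hba, -, hb⟩ := exists_le_of_smul_le (n := n) hx a fun i => by
      have h1 : (c i : ℝ) ≤ p * a i := by exact_mod_cast hca i
      have h2 := congrFun hcx i
      simp only [Pi.smul_apply, smul_eq_mul, Nat.cast_mul] at h2
      have hp' : (0 : ℝ) < p := by exact_mod_cast hp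
      refine le_of_mul_le_mul_left ?_ hp'
      rw [← mul_assoc, ← h2]
      exact h1
    exact ⟨b, hba, h n b (hhalf n b hb)⟩
  · rintro h n a ⟨x, hx, hax⟩
    have hai : ∀ i, (a i : ℝ) = n * x i := fun i => congrFun hax i
    rcases n.eq_zero_or_pos with rfl | hn
    · have : a = 0 := by
        ext i
        have := hai i
        simpa using this
      exact this ▸ IsEdgeSum.zero
    · have hdeg : a.degree = 2 * n := by
        obtain ⟨-, -, -, -, -, hx2⟩ := exists_weight_of_mem_edgePolytope hx
        have : (∑ i, (a i : ℝ)) = 2 * n := by simp_rw [hai, ← Finset.mul_sum, hx2, mul_comm]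
        rw [Finsupp.degree_eq_sum]
        exact_mod_cast this
      have heq : ∀ b ≤ a, b.degree = 2 * n → b = a := by
        intro b hba hb
        obtain ⟨d, rfl⟩ := exists_add_of_le hba
        have : d.degree = 0 := by
          rw [map_add] at hdeg
          omega
        rw [Finsupp.degree_eq_zero_iff] at this
        simp [this]
      obtain ⟨b, hba, hbd, hb⟩ := exists_le_of_smul_le hx a fun i => (hai i).ge
      obtain rfl := heq b hba hbd
      obtain ⟨c, hcb, hc⟩ := h n hn b ⟨2, one_le_two, _, le_rfl, hb⟩
      exact heq c hcb hc.degree_eq ▸ hc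

/-- Let `G` be a graph on `{t_1,…,t_s}` with at least one edge, with
edge ideal `I(G)`, edge polytope `P_G = conv{e_i + e_j : {t_i,t_j} ∈ E(G)} ⊆ ℝ^s`, and
Ehrhart ring `A(P_G) ⊆ S[z]`.  Then the `K`-subalgebra `K[I(G)z]` of `S[z]` generated by
the elements `t_i t_j z` over the edges of `G` equals `A(P_G)` iff `I(G)` is a normal
ideal. -/
theorem edgeSubring_eq_ehrhart_iff_normal
    {s : ℕ} (K : Type*) [Field K] (G : SimpleGraph (Fin s))
    (hEdge : ∃ i j : Fin s, G.Adj i j)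
    (I : Ideal (MvPolynomial (Fin s) K))
    (hI : I = Ideal.span {f : MvPolynomial (Fin s) K | ∃ i j : Fin s, G.Adj i j ∧ f = X i * X j})
    -- the subring `K[I(G)z]`:
    (A₀ : Subalgebra K (Polynomial (MvPolynomial (Fin s) K)))
    (hA₀ : A₀ = Algebra.adjoin K
      {p : Polynomial (MvPolynomial (Fin s) K) |
        ∃ i j : Fin s, G.Adj i j ∧ p = Polynomial.C (X i * X j) * Polynomial.X})
    -- the Ehrhart ring `A(P_G)` of the edge polytope, as a `K`-submodule of `S[z]`:
    (EhrhartSpan : Submodule K (Polynomial (MvPolynomial (Fin s) K)))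
    (hE : EhrhartSpan = Submodule.span K
      {p : Polynomial (MvPolynomial (Fin s) K) |
        ∃ (n : ℕ) (a : Fin s → ℕ),
          (∃ x ∈ convexHull ℝ {u : Fin s → ℝ | ∃ i j : Fin s, G.Adj i j ∧
              u = Pi.single i (1 : ℝ) + Pi.single j 1},
            (fun i : Fin s => (a i : ℝ)) = (n : ℝ) • x) ∧
          p = Polynomial.C (∏ i, X i ^ a i) * Polynomial.X ^ n}) :
    (A₀ : Set (Polynomial (MvPolynomial (Fin s) K))) =
        (EhrhartSpan : Set (Polynomial (MvPolynomial (Fin s) K))) ↔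
      (∀ n : ℕ, 1 ≤ n → ∀ a : Fin s → ℕ,
        (∃ p : ℕ, 1 ≤ p ∧ (∏ i, X i ^ a i : MvPolynomial (Fin s) K) ^ p ∈ I ^ (p * n)) →
        (∏ i, X i ^ a i : MvPolynomial (Fin s) K) ∈ I ^ n) := by
  subst hI hA₀ hE
  have hE' : {p : Polynomial (MvPolynomial (Fin s) K) |
        ∃ (n : ℕ) (a : Fin s → ℕ),
          (∃ x ∈ convexHull ℝ {u : Fin s → ℝ | ∃ i j : Fin s, G.Adj i j ∧
              u = Pi.single i (1 : ℝ) + Pi.single j 1},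
            (fun i : Fin s => (a i : ℝ)) = (n : ℝ) • x) ∧
          p = Polynomial.C (∏ i, X i ^ a i) * Polynomial.X ^ n} =
      (fun q : ℕ × (Fin s →₀ ℕ) => Polynomial.monomial q.1 (monomial q.2 (1 : K))) ''
        {q | ∃ x ∈ edgePolytope G, (fun i => (q.2 i : ℝ)) = (q.1 : ℝ) • x} := by
    ext f
    constructor
    · rintro ⟨n, a, h, rfl⟩
      refine ⟨(n, Finsupp.equivFunOnFinite.symm a), h, ?_⟩
      rw [prod_X_pow_eq_monomial_equivFunOnFinite, Polynomial.C_mul_X_pow_eq_monomial]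
    · rintro ⟨⟨n, a⟩, h, rfl⟩
      refine ⟨n, a, h, ?_⟩
      rw [prod_X_pow_eq_monomial_equivFunOnFinite, Polynomial.C_mul_X_pow_eq_monomial]
      ext
      simp
  rw [hE', ← Subalgebra.coe_toSubmodule, SetLike.coe_set_eq, edgeSubring_toSubmodule_eq_span]
  simp_rw [prod_X_pow_eq_monomial_equivFunOnFinite, monomial_pow, one_pow,
    monomial_mem_edgeIdeal_pow_iff]
  trans ∀ (n : ℕ) (a : Fin s →₀ ℕ),
      (∃ x ∈ edgePolytope G, (fun i => (a i : ℝ)) = (n : ℝ) • x) → IsEdgeSum G n a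
  · constructor
    · intro h n a ha
      refine (monomial_monomial_mem_span_iff (K := K) {q | IsEdgeSum G q.1 q.2} n a).mp ?_
      rw [h]
      exact Submodule.subset_span ⟨(n, a), ha, rfl⟩
    · intro h
      congr 2
      ext ⟨n, a⟩
      exact ⟨fun hq => hq.mem_smul_edgePolytope hEdge, h n a⟩
  · rw [edgeSums_eq_lattice_points_iff hEdge]
    refine forall₂_congr fun n _ => ?_
    exact Finsupp.equivFunOnFinite.symm.forall_congr_right.symm
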